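/- Let λ̄, μ̄₁, μ̄₂, μ̄₃ ∈ ℝ with μ̄₁, μ̄₂, μ̄₃ > 0, λ̄+2μ̄₁ > 0, λ̄+2μ̄₂ > 0, λ̄+2μ̄₃ ≥ 0 and (λ̄+2μ̄₁)(λ̄+2μ̄₃) − λ̄(λ̄+2μ̄₂) ≥ 0. For k = (k₁,k₂) ∈ ℝ² define the symmetric acoustic matrix A(k) := !![(λ̄+2μ̄₁)k₁² + μ̄₂k₂², (λ̄+μ̄₂)k₁k₂; (λ̄+μ̄₂)k₁k₂, (λ̄+2μ̄₃)k₂² + μ̄₂k₁²]. Then A(k) is positive semidefinite for every k ∈ ℝ²; equivalently, for every k both eigenvalues of A(k) are nonnegative, so all plane-wave speeds ω with ρ̄ω²η = A(k)η are real. -/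

import Mathlib

open Matrix

/-- The acoustic (Christoffel) matrix of the 2D orthorombic material. -/
noncomputable def acoustic (lb mb1 mb2 mb3 : ℝ) (k : Fin 2 → ℝ) :
    Matrix (Fin 2) (Fin 2) ℝ :=
  !![(lb + 2 * mb1) * k 0 ^ 2 + mb2 * k 1 ^ 2, (lb + mb2) * k 0 * k 1;
     (lb + mb2) * k 0 * k 1, (lb + 2 * mb3) * k 1 ^ 2 + mb2 * k 0 ^ 2]

lemma quad_nonneg (p b q x y : ℝ) (hp : 0 ≤ p) (hq : 0 ≤ q) (hd : 0 ≤ p * q - b ^ 2) :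
    0 ≤ p * x ^ 2 + 2 * b * x * y + q * y ^ 2 := by
  rcases hp.eq_or_lt with h | h
  · subst h
    have hb : b = 0 := by nlinarith [sq_nonneg b]
    subst hb
    have := mul_nonneg hq (sq_nonneg y)
    linarith
  · have h2 : 0 ≤ p * (p * x ^ 2 + 2 * b * x * y + q * y ^ 2) := by
      nlinarith [sq_nonneg (p * x + b * y), mul_nonneg hd (sq_nonneg y)]
    exact nonneg_of_mul_nonneg_right h2 h

theorem stmt11 (lb mb1 mb2 mb3 : ℝ)
    (hm1 : 0 < mb1) (hm2 : 0 < mb2) (hm3 : 0 < mb3)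
    (h1 : 0 < lb + 2 * mb1) (h2 : 0 < lb + 2 * mb2) (h3 : 0 ≤ lb + 2 * mb3)
    (h4 : 0 ≤ (lb + 2 * mb1) * (lb + 2 * mb3) - lb * (lb + 2 * mb2)) :
    ∀ k : Fin 2 → ℝ,
      (acoustic lb mb1 mb2 mb3 k).PosSemidef ∧
      ∀ (η : Fin 2 → ℝ) (r : ℝ), η ≠ 0 →
        (acoustic lb mb1 mb2 mb3 k) *ᵥ η = r • η → 0 ≤ r := by
  intro k
  have key : ∀ v : Fin 2 → ℝ, 0 ≤ v ⬝ᵥ (acoustic lb mb1 mb2 mb3 k *ᵥ v) := by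
    intro v
    have h := quad_nonneg ((lb + 2 * mb1) * k 0 ^ 2 + mb2 * k 1 ^ 2) ((lb + mb2) * k 0 * k 1)
      ((lb + 2 * mb3) * k 1 ^ 2 + mb2 * k 0 ^ 2) (v 0) (v 1) (by positivity) (by positivity) (by
        have e1 : 0 ≤ (lb + 2 * mb1) * mb2 * (k 0 ^ 2) ^ 2 := by positivity
        have e2 : 0 ≤ (lb + 2 * mb3) * mb2 * (k 1 ^ 2) ^ 2 := by positivity
        have e3 := mul_nonneg h4 (mul_nonneg (sq_nonneg (k 0)) (sq_nonneg (k 1)))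
        linarith)
    simp only [acoustic, dotProduct, mulVec, Fin.sum_univ_two, of_apply, cons_val_zero,
      cons_val_one, cons_val_fin_one]
    linarith
  refine ⟨PosSemidef.of_dotProduct_mulVec_nonneg ?_ (fun v => by simpa using key v), ?_⟩
  · ext i j
    fin_cases i <;> fin_cases j <;> simp [acoustic]
  · intro η r hη h
    have hk := key η
    rw [h, dotProduct_smul, smul_eq_mul] at hk
    have hpos : 0 < η ⬝ᵥ η := by
      have h0 : 0 ≤ η ⬝ᵥ η := Finset.sum_nonneg fun i _ => mul_self_nonneg _
      exact lt_of_le_of_ne h0 fun e => hη (dotProduct_self_eq_zero.1 e.symm)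
    exact nonneg_of_mul_nonneg_left hk hpos
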